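/- For a finite set S₁ = {s(1) < ... < s(k)} of positive integers with s(1) = 1 and k ≥ 2, let g(S₁) denote the open interval (H(S₂), H(S₁)), where S₂ = {s(1), ..., s(k−1)} ∪ {m : m ≥ s(k) + 1}. Then for distinct finite sets S₁ and S₁' of this form, the intervals g(S₁) and g(S₁') are disjoint. -/

import Mathlib

open scoped Classical

/-- `charFn S` is the characteristic function `u` of a set `S` of positive integers. -/
noncomputable def charFn (S : Set ℕ) (n : ℕ) : ℝ := if n ∈ S then 1 else 0

/-- `H S = ∏_p (1 + Σ_{i ≥ 2} (u(i) - u(i-1)) / p^i)`, the product over all primes. -/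
noncomputable def H (S : Set ℕ) : ℝ :=
  ∏' p : Nat.Primes,
    (1 + ∑' i : ℕ, (charFn S (i + 2) - charFn S (i + 1)) / ((p : ℕ) : ℝ) ^ (i + 2))

/-- The exponentially `S`-numbers: positive integers all of whose prime-factorization
exponents lie in `S`. -/
def ExpS (S : Set ℕ) : Set ℕ :=
  {N | 0 < N ∧ ∀ p : ℕ, p.Prime → p ∣ N → N.factorization p ∈ S}

/-- The set `D` of all densities `H S` as `S` ranges over sets of positive integers
containing `1`. -/
noncomputable def densitySet : Set ℝ :=
  {x | ∃ S : Set ℕ, 1 ∈ S ∧ (∀ n ∈ S, 0 < n) ∧ H S = x}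

/-- The coefficient of the Euler factor of `H S`, as a function of `q = 1 / p`. -/
noncomputable def eulerTerm (S : Set ℕ) (q : ℝ) : ℝ :=
  ∑' i : ℕ, (charFn S (i + 2) - charFn S (i + 1)) * q ^ (i + 2)

theorem charFn_nonneg (S : Set ℕ) (n : ℕ) : 0 ≤ charFn S n := by
  unfold charFn; split_ifs <;> norm_num

theorem charFn_le_one (S : Set ℕ) (n : ℕ) : charFn S n ≤ 1 := by
  unfold charFn; split_ifs <;> norm_num

theorem abs_charFn_sub_le_one (S T : Set ℕ) (m n : ℕ) : |charFn S m - charFn T n| ≤ 1 :=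
  abs_sub_le_iff.2
    ⟨by linarith [charFn_nonneg T n, charFn_le_one S m],
      by linarith [charFn_nonneg S m, charFn_le_one T n]⟩

theorem H_eq_tprod_eulerTerm (S : Set ℕ) :
    H S = ∏' p : Nat.Primes, (1 + eulerTerm S (((p : ℕ) : ℝ)⁻¹)) := by
  simp only [H, eulerTerm, inv_pow, div_eq_mul_inv]

theorem summable_bounded_mul_pow {d : ℕ → ℝ} (hd : ∀ i, |d i| ≤ 1) {q : ℝ} (hq0 : 0 ≤ q)
    (hq1 : q < 1) : Summable fun i => d i * q ^ i := by
  refine Summable.of_norm_bounded (summable_geometric_of_lt_one hq0 hq1) fun i => ?_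
  rw [Real.norm_eq_abs, abs_mul, abs_of_nonneg (pow_nonneg hq0 i)]
  exact mul_le_of_le_one_left (pow_nonneg hq0 i) (hd i)

theorem abs_tsum_bounded_mul_pow_le {d : ℕ → ℝ} (hd : ∀ i, |d i| ≤ 1) {q : ℝ} (hq0 : 0 ≤ q)
    (hq1 : q < 1) : |∑' i, d i * q ^ i| ≤ (1 - q)⁻¹ := by
  rw [← Real.norm_eq_abs]
  refine tsum_of_norm_bounded (hasSum_geometric_of_lt_one hq0 hq1) fun i => ?_
  rw [Real.norm_eq_abs, abs_mul, abs_of_nonneg (pow_nonneg hq0 i)]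
  exact mul_le_of_le_one_left (pow_nonneg hq0 i) (hd i)

theorem eulerTerm_eq_sq_mul_tsum (S : Set ℕ) (q : ℝ) :
    eulerTerm S q = q ^ 2 * ∑' i : ℕ, (charFn S (i + 2) - charFn S (i + 1)) * q ^ i := by
  rw [eulerTerm, ← tsum_mul_left]
  exact tsum_congr fun i => by ring

theorem abs_eulerTerm_le (S : Set ℕ) {q : ℝ} (hq0 : 0 ≤ q) (hq : q ≤ 1 / 2) :
    |eulerTerm S q| ≤ 2 * q ^ 2 := by
  have h := abs_tsum_bounded_mul_pow_le
    (fun i => abs_charFn_sub_le_one S S (i + 2) (i + 1)) hq0 (by linarith)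
  have h2 : (1 - q)⁻¹ ≤ 2 := inv_le_of_inv_le₀ (by norm_num) (by linarith)
  rw [eulerTerm_eq_sq_mul_tsum, abs_mul, abs_of_nonneg (sq_nonneg q)]
  nlinarith [sq_nonneg q]

theorem eulerTerm_eq (S : Set ℕ) (h1 : 1 ∈ S) {q : ℝ} (hq0 : 0 ≤ q) (hq1 : q < 1) :
    eulerTerm S q = q ^ 2 * ((1 - q) * ∑' i : ℕ, charFn S (i + 2) * q ^ i - 1) := by
  have hs (k : ℕ) : Summable fun i => charFn S (i + k) * q ^ i :=
    summable_bounded_mul_pow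
      (fun i => by rw [abs_of_nonneg (charFn_nonneg _ _)]; exact charFn_le_one _ _) hq0 hq1
  have h : ∑' i : ℕ, charFn S (i + 1) * q ^ i
      = 1 + q * ∑' i : ℕ, charFn S (i + 2) * q ^ i := by
    rw [(hs 1).tsum_eq_zero_add, ← tsum_mul_left]
    congr 1
    · simp [charFn, h1]
    · exact tsum_congr fun i => by ring
  rw [eulerTerm_eq_sq_mul_tsum]
  simp only [sub_mul]
  rw [(hs 2).tsum_sub (hs 1), h]
  ring

theorem inv_prime_le_half (p : Nat.Primes) : ((p : ℕ) : ℝ)⁻¹ ≤ 1 / 2 := by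
  rw [one_div]
  exact inv_anti₀ (by norm_num) (by exact_mod_cast p.2.two_le)

theorem multipliable_one_add_eulerTerm (S : Set ℕ) :
    Multipliable fun p : Nat.Primes => 1 + eulerTerm S (((p : ℕ) : ℝ)⁻¹) := by
  apply multipliable_one_add_of_summable
  have h : Summable fun p : Nat.Primes => 2 * (((p : ℕ) : ℝ)⁻¹) ^ 2 := by
    simp only [inv_pow]
    exact ((Real.summable_nat_pow_inv.2 one_lt_two).comp_injective
      (Nat.Primes.coe_nat_injective)).mul_left 2
  exact h.of_nonneg_of_le (fun _ => norm_nonneg _) fun p =>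
    abs_eulerTerm_le S (by positivity) (inv_prime_le_half p)

theorem H_le_of_tsum_nonneg {S T : Set ℕ} (h1S : 1 ∈ S) (h1T : 1 ∈ T)
    (h : ∀ q : ℝ, 0 ≤ q → q ≤ 1 / 2 →
      0 ≤ ∑' i : ℕ, (charFn S (i + 2) - charFn T (i + 2)) * q ^ i) : H T ≤ H S := by
  rw [H_eq_tprod_eulerTerm, H_eq_tprod_eulerTerm]
  refine le_of_tendsto_of_tendsto' (multipliable_one_add_eulerTerm T).hasProd
    (multipliable_one_add_eulerTerm S).hasProd fun s => ?_
  refine Finset.prod_le_prod (fun p _ => ?_) fun p _ => ?_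
  all_goals
    have hq0 : 0 ≤ ((p : ℕ) : ℝ)⁻¹ := by positivity
    have hq := inv_prime_le_half p
    generalize ((p : ℕ) : ℝ)⁻¹ = q at hq0 hq
  · have := (abs_le.1 (abs_eulerTerm_le T hq0 hq)).1
    nlinarith
  · have hs (U : Set ℕ) : Summable fun i => charFn U (i + 2) * q ^ i :=
      summable_bounded_mul_pow
        (fun i => by rw [abs_of_nonneg (charFn_nonneg _ _)]; exact charFn_le_one _ _)
        hq0 (by linarith)
    have hd := h q hq0 hq
    simp only [sub_mul] at hd
    rw [(hs S).tsum_sub (hs T)] at hd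
    rw [eulerTerm_eq S h1S hq0 (by linarith), eulerTerm_eq T h1T hq0 (by linarith)]
    have hmul := mul_le_mul_of_nonneg_left (sub_nonneg.1 hd) (by linarith : 0 ≤ 1 - q)
    nlinarith [mul_le_mul_of_nonneg_left hmul (sq_nonneg q)]

theorem H_mono {S T : Set ℕ} (h1T : 1 ∈ T) (h : T ⊆ S) : H T ≤ H S := by
  refine H_le_of_tsum_nonneg (h h1T) h1T fun q hq0 _ => tsum_nonneg fun i => ?_
  refine mul_nonneg (sub_nonneg.2 ?_) (pow_nonneg hq0 i)
  unfold charFn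
  split_ifs with hT hS
  · exact le_rfl
  · exact absurd (h hT) hS
  · exact zero_le_one
  · exact le_rfl

/-- `H` is monotone for the lexicographic order on sets containing `1`. -/
theorem H_le_of_lex {S T : Set ℕ} (h1S : 1 ∈ S) (h1T : 1 ∈ T) {n : ℕ} (hn : 2 ≤ n)
    (hnS : n ∈ S) (hnT : n ∉ T) (h : ∀ i < n, i ∈ S ↔ i ∈ T) : H T ≤ H S := by
  obtain ⟨m, rfl⟩ := Nat.exists_eq_add_of_le' hn
  refine H_le_of_tsum_nonneg h1S h1T fun q hq0 hq => ?_
  have hq1 : q < 1 := by linarith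
  have hb (i : ℕ) := abs_charFn_sub_le_one S T (i + 2) (i + 2)
  rw [← (summable_bounded_mul_pow hb hq0 hq1).sum_add_tsum_nat_add (m + 1),
    Finset.sum_range_succ, Finset.sum_eq_zero]
  · have htail : ∑' i : ℕ, (charFn S (i + (m + 1) + 2) - charFn T (i + (m + 1) + 2))
          * q ^ (i + (m + 1))
        = q ^ m * (q * ∑' i : ℕ, (charFn S (i + (m + 1) + 2) - charFn T (i + (m + 1) + 2))
          * q ^ i) := by
      rw [← tsum_mul_left, ← tsum_mul_left]
      exact tsum_congr fun i => by ring
    have hbound := (abs_le.1 (abs_tsum_bounded_mul_pow_le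
      (fun i => hb (i + (m + 1))) hq0 hq1)).1
    have h2 : (1 - q)⁻¹ ≤ 2 := inv_le_of_inv_le₀ (by norm_num) (by linarith)
    rw [htail]
    have hhead : charFn S (m + 2) - charFn T (m + 2) = 1 := by simp [charFn, hnS, hnT]
    rw [hhead, zero_add, one_mul, ← mul_one_add]
    refine mul_nonneg (pow_nonneg hq0 m) ?_
    nlinarith
  · intro i hi
    have := h (i + 2) (by have := Finset.mem_range.1 hi; omega)
    simp [charFn, this]

theorem H_le_H_gap_left {S T : Set ℕ} (h1S : 1 ∈ S) (h1T : 1 ∈ T) {s n : ℕ}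
    (hsmax : ∀ m ∈ S, m ≤ s) (hs1 : 1 < s) (hn : 2 ≤ n) (hnS : n ∈ S) (hnT : n ∉ T)
    (h : ∀ i < n, i ∈ S ↔ i ∈ T) : H T ≤ H ((S \ {s}) ∪ {m : ℕ | s + 1 ≤ m}) := by
  rcases (hsmax n hnS).lt_or_eq with hlt | rfl
  · refine H_le_of_lex (Or.inl ⟨h1S, hs1.ne⟩) h1T hn (Or.inl ⟨hnS, hlt.ne⟩) hnT fun i hi => ?_
    rw [← h i hi]
    simp only [Set.mem_union, Set.mem_sdiff, Set.mem_singleton_iff, Set.mem_ofPred_eq]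
    have h1 : i ≠ s := by omega
    have h2 : ¬ s + 1 ≤ i := by omega
    simp [h1, h2]
  · refine H_mono h1T fun i hi => ?_
    rcases lt_trichotomy i n with hlt | rfl | hgt
    · exact Or.inl ⟨(h i hlt).2 hi, hlt.ne⟩
    · exact absurd hi hnT
    · exact Or.inr hgt

theorem exists_first_difference {S T : Set ℕ} (hne : S ≠ T) :
    ∃ n, ¬(n ∈ S ↔ n ∈ T) ∧ ∀ i < n, (i ∈ S ↔ i ∈ T) := by
  have hex : ∃ n, ¬(n ∈ S ↔ n ∈ T) := by
    by_contra! hall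
    exact hne (Set.ext hall)
  exact ⟨Nat.find hex, Nat.find_spec hex, fun i hi => not_not.1 (Nat.find_min hex hi)⟩

theorem gaps_disjoint (S₁ T₁ : Set ℕ) (hfS : S₁.Finite) (hfT : T₁.Finite)
    (h1S : 1 ∈ S₁) (h1T : 1 ∈ T₁)
    (hposS : ∀ n ∈ S₁, 0 < n) (hposT : ∀ n ∈ T₁, 0 < n)
    (s t : ℕ) (hsS : s ∈ S₁) (hsmax : ∀ m ∈ S₁, m ≤ s) (hs1 : 1 < s)
    (htT : t ∈ T₁) (htmax : ∀ m ∈ T₁, m ≤ t) (ht1 : 1 < t)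
    (hne : S₁ ≠ T₁) :
    Disjoint (Set.Ioo (H ((S₁ \ {s}) ∪ {m : ℕ | s + 1 ≤ m})) (H S₁))
             (Set.Ioo (H ((T₁ \ {t}) ∪ {m : ℕ | t + 1 ≤ m})) (H T₁)) := by
  obtain ⟨n, hn, hlt⟩ := exists_first_difference hne
  have hn2 : 2 ≤ n := by
    by_contra! hn2
    interval_cases n
    · exact hn ⟨fun h => absurd (hposS 0 h) (lt_irrefl 0),
        fun h => absurd (hposT 0 h) (lt_irrefl 0)⟩
    · exact hn ⟨fun _ => h1T, fun _ => h1S⟩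
  rw [Set.disjoint_left]
  rintro x ⟨hx1, hx2⟩ ⟨hx3, hx4⟩
  by_cases hnS : n ∈ S₁
  · have hnT : n ∉ T₁ := fun hnT => hn ⟨fun _ => hnT, fun _ => hnS⟩
    linarith [H_le_H_gap_left h1S h1T hsmax hs1 hn2 hnS hnT hlt]
  · have hnT : n ∈ T₁ := by
      by_contra hnT
      exact hn ⟨fun h => absurd h hnS, fun h => absurd h hnT⟩
    linarith [H_le_H_gap_left h1T h1S htmax ht1 hn2 hnT hnS fun i hi => (hlt i hi).symm]
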